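/- arXiv:1011.4296 — 8 statements merged into one kernel-verified Lean document; each statement's English description precedes it below -/
import Mathlib

section
/- Let D = {(ξ₂, ξ₃) ∈ ℝ² : ξ₂ > 0, 0 < ξ₃ < 3, ξ₂ + ξ₃ < 6} and define Z(ξ₂, ξ₃) = (6 − ξ₃)/(ξ₂·ξ₃·(3 − ξ₃)·(6 − ξ₂ − ξ₃)). Then for all (ξ₂, ξ₃) ∈ D one has Z(ξ₂, ξ₃) ≥ 2√3/9, with equality if and only if ξ₂ = (3 + √3)/2 and ξ₃ = 3 − √3. -/
/-- Z-minimization for the suspended pinch point: on the Reeb cone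
D = {ξ₂ > 0, 0 < ξ₃ < 3, ξ₂ + ξ₃ < 6}, the normalized contact volume
Z(ξ₂,ξ₃) = (6−ξ₃)/(ξ₂ξ₃(3−ξ₃)(6−ξ₂−ξ₃)) satisfies Z ≥ 2√3/9, with equality
iff ξ₂ = (3+√3)/2 and ξ₃ = 3−√3. -/
theorem contact_volume_SPP_min (ξ₂ ξ₃ : ℝ)
    (h₂ : 0 < ξ₂) (h₃ : 0 < ξ₃) (h₃' : ξ₃ < 3) (hs : ξ₂ + ξ₃ < 6) :
    2 * Real.sqrt 3 / 9 ≤ (6 - ξ₃) / (ξ₂ * ξ₃ * (3 - ξ₃) * (6 - ξ₂ - ξ₃)) ∧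
      ((6 - ξ₃) / (ξ₂ * ξ₃ * (3 - ξ₃) * (6 - ξ₂ - ξ₃)) = 2 * Real.sqrt 3 / 9 ↔
        ξ₂ = (3 + Real.sqrt 3) / 2 ∧ ξ₃ = 3 - Real.sqrt 3) := by
  obtain ⟨s, hsdef⟩ : ∃ s, s = Real.sqrt 3 := ⟨_, rfl⟩
  have hs0 : 0 < s := by rw [hsdef]; positivity
  have hs2 : s ^ 2 = 3 := by rw [hsdef]; norm_num
  rw [← hsdef]
  have hu : 0 < 3 - ξ₃ := by linarith
  have hv : 0 < 6 - ξ₂ - ξ₃ := by linarith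
  have hw : 0 < 6 - ξ₃ := by linarith
  have hD : 0 < ξ₂ * ξ₃ * (3 - ξ₃) * (6 - ξ₂ - ξ₃) := by positivity
  have key : (6 - ξ₃) * 9 - 2 * s * (ξ₂ * ξ₃ * (3 - ξ₃) * (6 - ξ₂ - ξ₃)) =
      (s / 2 * (6 - ξ₃) * (3 - ξ₃ + 2 * s)) * (3 - ξ₃ - s) ^ 2
        + (2 * s * ξ₃ * (3 - ξ₃)) * (ξ₂ - (6 - ξ₃) / 2) ^ 2 := by
    have h4 : s ^ 4 = 9 := by rw [show s ^ 4 = (s ^ 2) ^ 2 by ring, hs2]; norm_num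
    ring_nf
    have h5 : s ^ 3 = 3 * s := by rw [show s ^ 3 = s ^ 2 * s by ring, hs2]
    rw [h4, h5]
    ring
  have hA : 0 < s / 2 * (6 - ξ₃) * (3 - ξ₃ + 2 * s) := by positivity
  have hB : 0 < 2 * s * ξ₃ * (3 - ξ₃) := by positivity
  have h1 := mul_nonneg hA.le (sq_nonneg (3 - ξ₃ - s))
  have h2 := mul_nonneg hB.le (sq_nonneg (ξ₂ - (6 - ξ₃) / 2))
  constructor
  · rw [div_le_div_iff₀ (by norm_num) hD]
    linarith
  · rw [div_eq_div_iff hD.ne' (by norm_num)]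
    constructor
    · intro h
      have e1 : (s / 2 * (6 - ξ₃) * (3 - ξ₃ + 2 * s)) * (3 - ξ₃ - s) ^ 2 = 0 := by linarith
      have e2 : (2 * s * ξ₃ * (3 - ξ₃)) * (ξ₂ - (6 - ξ₃) / 2) ^ 2 = 0 := by linarith
      have f1 := pow_eq_zero_iff (two_ne_zero) |>.mp ((mul_eq_zero.mp e1).resolve_left hA.ne')
      have f2 := pow_eq_zero_iff (two_ne_zero) |>.mp ((mul_eq_zero.mp e2).resolve_left hB.ne')
      constructor <;> linarith
    · rintro ⟨a, b⟩
      have f1 : 3 - ξ₃ - s = 0 := by linarith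
      have f2 : ξ₂ - (6 - ξ₃) / 2 = 0 := by linarith
      rw [f1, f2] at key
      linarith
end

section
/- The function Z(ξ₂, ξ₃) = (6 − ξ₃)/(ξ₂·ξ₃·(3 − ξ₃)·(6 − ξ₂ − ξ₃)) is strictly convex on the convex open set D = {(ξ₂, ξ₃) ∈ ℝ² : ξ₂ > 0, 0 < ξ₃ < 3, ξ₂ + ξ₃ < 6}. -/
lemma aux_amgm (s t : ℝ) (hs : 0 < s) (ht : 0 < t) (h : s ≠ 1 ∨ t ≠ 1) :
    3 - s - t < 1 / (s * t) := by
  rw [lt_div_iff₀ (mul_pos hs ht)]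
  have hst := mul_pos hs ht
  by_cases hw : 3 - s - t ≤ 0
  · nlinarith
  · push Not at hw
    have key : 1 - (3 - s - t) * (s * t)
        = (1 - (s + t) / 2) ^ 2 * (1 + s + t) + ((s - t) / 2) ^ 2 * (3 - s - t) := by ring
    have h1 : 0 ≤ (1 - (s + t) / 2) ^ 2 * (1 + s + t) := by positivity
    have h2 : 0 ≤ ((s - t) / 2) ^ 2 * (3 - s - t) := by positivity
    by_cases hd : s = t
    · subst hd
      have hs1 : 1 - (s + s) / 2 ≠ 0 := by
        intro h0
        have : s = 1 := by linarith
        simp [this] at h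
      have : 0 < (1 - (s + s) / 2) ^ 2 * (1 + s + s) := by positivity
      linarith
    · have hd' : (s - t) / 2 ≠ 0 := by
        intro h0
        exact hd (by linarith)
      have : 0 < ((s - t) / 2) ^ 2 * (3 - s - t) := by positivity
      linarith

lemma aux_tangent (u v U V : ℝ) (hu : 0 < u) (hv : 0 < v) (hU : 0 < U) (hV : 0 < V)
    (h : u ≠ U ∨ v ≠ V) :
    1 / (U * V) * (3 - u / U - v / V) < 1 / (u * v) := by
  have := aux_amgm (u / U) (v / V) (by positivity) (by positivity)
    (by
      rcases h with h | h
      · left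
        rwa [Ne, div_eq_one_iff_eq hU.ne']
      · right
        rwa [Ne, div_eq_one_iff_eq hV.ne'])
  have h2 := mul_lt_mul_of_pos_left this (show 0 < 1 / (U * V) by positivity)
  refine h2.trans_eq ?_
  field_simp

lemma aux_conv (a b u v u' v' : ℝ) (ha : 0 < a) (hb : 0 < b) (hab : a + b = 1)
    (hu : 0 < u) (hv : 0 < v) (hu' : 0 < u') (hv' : 0 < v') (h : u ≠ u' ∨ v ≠ v') :
    1 / ((a * u + b * u') * (a * v + b * v')) < a * (1 / (u * v)) + b * (1 / (u' * v')) := by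
  obtain ⟨U, hUe⟩ : ∃ U, U = a * u + b * u' := ⟨_, rfl⟩
  obtain ⟨V, hVe⟩ : ∃ V, V = a * v + b * v' := ⟨_, rfl⟩
  have hU : 0 < U := by rw [hUe]; positivity
  have hV : 0 < V := by rw [hVe]; positivity
  have ha' : a = 1 - b := by linarith
  have t1 := aux_tangent u v U V hu hv hU hV (by
    refine h.imp ?_ ?_ <;> intro hne he <;> apply hne <;> apply mul_left_cancel₀ hb.ne' <;>
    subst ha' <;> linarith)
  have t2 := aux_tangent u' v' U V hu' hv' hU hV (by
    have hb' : b = 1 - a := by linarith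
    clear ha'
    refine h.imp ?_ ?_ <;> intro hne he <;> apply hne <;> apply mul_left_cancel₀ ha.ne' <;>
    subst hb' <;> linarith)
  rw [← hUe, ← hVe]
  have e : a * (1 / (U * V) * (3 - u / U - v / V)) + b * (1 / (U * V) * (3 - u' / U - v' / V))
      = 1 / (U * V) := by
    have : a * (1 / (U * V) * (3 - u / U - v / V)) + b * (1 / (U * V) * (3 - u' / U - v' / V))
      = 1 / (U * V) * (3 * (a + b) - (a * u + b * u') / U - (a * v + b * v') / V) := by ring
    rw [this, ← hUe, ← hVe, hab, div_self hU.ne', div_self hV.ne']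
    ring
  have := mul_lt_mul_of_pos_left t1 ha
  have := mul_lt_mul_of_pos_left t2 hb
  linarith

lemma aux_split (x y : ℝ) (hx : 0 < x) (hy : 0 < y) (hy3 : 0 < 3 - y) (hxy : 0 < 6 - x - y) :
    (6 - y) / (x * y * (3 - y) * (6 - x - y)) =
      (1 / (x * y) + 1 / (x * (3 - y)) + 1 / ((6 - x - y) * y)
        + 1 / ((6 - x - y) * (3 - y))) / 3 := by
  field_simp
  ring

/-- The SPP contact volume Z(ξ₂,ξ₃) = (6−ξ₃)/(ξ₂ξ₃(3−ξ₃)(6−ξ₂−ξ₃)) is strictly convex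
on the convex open set D = {ξ₂ > 0, 0 < ξ₃ < 3, ξ₂ + ξ₃ < 6}. -/
theorem contact_volume_SPP_strictConvexOn :
    StrictConvexOn ℝ {p : ℝ × ℝ | 0 < p.1 ∧ 0 < p.2 ∧ p.2 < 3 ∧ p.1 + p.2 < 6}
      (fun p : ℝ × ℝ => (6 - p.2) / (p.1 * p.2 * (3 - p.2) * (6 - p.1 - p.2))) := by
  constructor
  · rintro ⟨x, y⟩ ⟨h1, h2, h3, h4⟩ ⟨x', y'⟩ ⟨h1', h2', h3', h4'⟩ a b ha hb hab
    simp only [Set.mem_setOf_eq, Prod.smul_mk, Prod.mk_add_mk, smul_eq_mul] at *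
    have ha' : a = 1 - b := by linarith
    rcases ha.eq_or_lt with h0 | h0
    · have : b = 1 := by linarith
      subst this
      rw [← h0]
      refine ⟨?_, ?_, ?_, ?_⟩ <;> linarith
    · have hy3 : 0 < 3 - y := by linarith
      have hy3' : 0 ≤ 3 - y' := by linarith
      have hz : 0 < 6 - x - y := by linarith
      have hz' : 0 ≤ 6 - x' - y' := by linarith
      have p1 : 0 < a * (3 - y) + b * (3 - y') := by positivity
      have p2 : 0 < a * (6 - x - y) + b * (6 - x' - y') := by positivity
      refine ⟨by positivity, by positivity, ?_, ?_⟩ <;> nlinarith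
  · rintro ⟨x, y⟩ ⟨h1, h2, h3, h4⟩ ⟨x', y'⟩ ⟨h1', h2', h3', h4'⟩ hne a b ha hb hab
    simp only [Prod.smul_mk, Prod.mk_add_mk, smul_eq_mul] at *
    have hne' : x ≠ x' ∨ y ≠ y' := by
      by_contra hc
      push Not at hc
      exact hne (by rw [hc.1, hc.2])
    have hy3 : 0 < 3 - y := by linarith
    have hy3' : 0 < 3 - y' := by linarith
    have hz : 0 < 6 - x - y := by linarith
    have hz' : 0 < 6 - x' - y' := by linarith
    have e1 : a * (3 - y) + b * (3 - y') = 3 - (a * y + b * y') := by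
      linear_combination 3 * hab
    have e2 : a * (6 - x - y) + b * (6 - x' - y') = 6 - (a * x + b * x') - (a * y + b * y') := by
      linear_combination 6 * hab
    have n2 : x ≠ x' ∨ 3 - y ≠ 3 - y' := hne'.imp id (fun h h' => h (by linarith))
    have n3 : 6 - x - y ≠ 6 - x' - y' ∨ y ≠ y' := by
      by_cases hy : y = y'
      · left
        intro h
        rcases hne' with h' | h'
        · exact h' (by linarith)
        · exact h' hy
      · exact Or.inr hy
    have n4 : 6 - x - y ≠ 6 - x' - y' ∨ 3 - y ≠ 3 - y' := n3.imp id (fun h h' => h (by linarith))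
    have c1 := aux_conv a b x y x' y' ha hb hab h1 h2 h1' h2' hne'
    have c2 := aux_conv a b x (3 - y) x' (3 - y') ha hb hab h1 hy3 h1' hy3' n2
    have c3 := aux_conv a b (6 - x - y) y (6 - x' - y') y' ha hb hab hz h2 hz' h2' n3
    have c4 := aux_conv a b (6 - x - y) (3 - y) (6 - x' - y') (3 - y') ha hb hab hz hy3 hz' hy3' n4
    rw [e1] at c2 c4
    rw [e2] at c3 c4
    rw [aux_split x y h1 h2 hy3 hz, aux_split x' y' h1' h2' hy3' hz',
      aux_split (a * x + b * x') (a * y + b * y') (by positivity) (by positivity)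
        (by rw [← e1]; positivity) (by rw [← e2]; positivity)]
    linarith
end

section
/- Fix N > 0 and let (ξ₂, ξ₃) ∈ D = {(ξ₂, ξ₃) ∈ ℝ² : ξ₂ > 0, 0 < ξ₃ < 3, ξ₂ + ξ₃ < 6}. Define Z = (6 − ξ₃)/(ξ₂ξ₃(3 − ξ₃)(6 − ξ₂ − ξ₃)), D₁ = ξ₃(6 − ξ₂ − ξ₃), D₂ = (3 − ξ₃)(6 − ξ₂ − ξ₃), D₃ = ξ₂(3 − ξ₃), D₄ = ξ₂ξ₃, and R_α = 2/(3·Z·D_α) for α = 1,2,3,4. Set a_trial = (9N²/32)·[3 + 2(R₁ − 1)³ + (R₂ − 1)³ + (R₃ − 1)³ + 2(R₄ − 1)³ + (R₂ + R₃ − 1)³]. Then Z · a_trial = N²/4 identically on D. -/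
/-- Equivalence of Z-minimization and a-maximization for the SPP theory:
with trial R-charges R_α = 2/(3·Z·D_α) determined by the contact volumes,
the trial central charge a_trial satisfies Z · a_trial = N²/4 identically on the Reeb cone. -/
theorem Z_times_a_trial_SPP (N : ℝ) (hN : 0 < N)
    (ξ₂ ξ₃ : ℝ) (h₂ : 0 < ξ₂) (h₃ : 0 < ξ₃) (h₃' : ξ₃ < 3) (hs : ξ₂ + ξ₃ < 6)
    (Z D₁ D₂ D₃ D₄ R₁ R₂ R₃ R₄ atrial : ℝ)
    (hZ : Z = (6 - ξ₃) / (ξ₂ * ξ₃ * (3 - ξ₃) * (6 - ξ₂ - ξ₃)))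
    (hD₁ : D₁ = ξ₃ * (6 - ξ₂ - ξ₃))
    (hD₂ : D₂ = (3 - ξ₃) * (6 - ξ₂ - ξ₃))
    (hD₃ : D₃ = ξ₂ * (3 - ξ₃))
    (hD₄ : D₄ = ξ₂ * ξ₃)
    (hR₁ : R₁ = 2 / (3 * Z * D₁))
    (hR₂ : R₂ = 2 / (3 * Z * D₂))
    (hR₃ : R₃ = 2 / (3 * Z * D₃))
    (hR₄ : R₄ = 2 / (3 * Z * D₄))
    (ha : atrial = (9 * N ^ 2 / 32) *
      (3 + 2 * (R₁ - 1) ^ 3 + (R₂ - 1) ^ 3 + (R₃ - 1) ^ 3 + 2 * (R₄ - 1) ^ 3 +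
        (R₂ + R₃ - 1) ^ 3)) :
    Z * atrial = N ^ 2 / 4 := by
  have ht : 3 - ξ₃ ≠ 0 := by
    apply ne_of_gt; linarith
  have hu : 6 - ξ₂ - ξ₃ ≠ 0 := by
    apply ne_of_gt; linarith
  have hs6 : 6 - ξ₃ ≠ 0 := by
    apply ne_of_gt; linarith
  have hy : ξ₂ ≠ 0 := h₂.ne'
  have hx : ξ₃ ≠ 0 := h₃.ne'
  have e₁ : R₁ = 2 * ξ₂ * (3 - ξ₃) / (3 * (6 - ξ₃)) := by
    rw [hR₁, hZ, hD₁]; field_simp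
  have e₂ : R₂ = 2 * ξ₂ * ξ₃ / (3 * (6 - ξ₃)) := by
    rw [hR₂, hZ, hD₂]; field_simp
  have e₃ : R₃ = 2 * ξ₃ * (6 - ξ₂ - ξ₃) / (3 * (6 - ξ₃)) := by
    rw [hR₃, hZ, hD₃]; field_simp
  have e₄ : R₄ = 2 * (3 - ξ₃) * (6 - ξ₂ - ξ₃) / (3 * (6 - ξ₃)) := by
    rw [hR₄, hZ, hD₄]; field_simp
  rw [ha, e₁, e₂, e₃, e₄, hZ]
  field_simp
  ring
end

section
/- Fix N > 0. Consider the trial central charge a_trial(R₁₂, R₂₁, R₁₃, R₃₁, R₂₃, R₃₂, R₃₃) = (9N²/32)·[3 + (R₁₂−1)³ + (R₂₁−1)³ + (R₁₃−1)³ + (R₃₁−1)³ + (R₂₃−1)³ + (R₃₂−1)³ + (R₃₃−1)³] restricted to the affine constraint set C = {R₁₂ + R₂₁ + R₂₃ + R₃₂ = 2, R₂₃ + R₃₂ = R₁₃ + R₃₁, R₁₂ + R₂₁ = R₃₃}. Then the point with R₂₃ = R₃₂ = R₁₃ = R₃₁ = 1/√3, R₁₂ = R₂₁ = 1 − 1/√3,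 R₃₃ = 2 − 2/√3 lies in C, is a local maximum of a_trial restricted to C, and at this point a_trial = 3√3·N²/8. -/
/-- a-maximization for the suspended pinch point theory. Index the seven R-charges as
R 0 = R₁₂, R 1 = R₂₁, R 2 = R₁₃, R 3 = R₃₁, R 4 = R₂₃, R 5 = R₃₂, R 6 = R₃₃.
The point with R₂₃ = R₃₂ = R₁₃ = R₃₁ = 1/√3, R₁₂ = R₂₁ = 1 − 1/√3, R₃₃ = 2 − 2/√3
lies in the constraint set C, is a local maximum of a_trial on C, and there
a_trial = 3√3·N²/8. -/
theorem a_maximization_SPP (N : ℝ) (hN : 0 < N) :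
    let C : Set (Fin 7 → ℝ) :=
      {R | R 0 + R 1 + R 4 + R 5 = 2 ∧ R 4 + R 5 = R 2 + R 3 ∧ R 0 + R 1 = R 6}
    let atrial : (Fin 7 → ℝ) → ℝ := fun R =>
      (9 * N ^ 2 / 32) * (3 + (R 0 - 1) ^ 3 + (R 1 - 1) ^ 3 + (R 2 - 1) ^ 3 +
        (R 3 - 1) ^ 3 + (R 4 - 1) ^ 3 + (R 5 - 1) ^ 3 + (R 6 - 1) ^ 3)
    let p : Fin 7 → ℝ :=
      ![1 - 1 / Real.sqrt 3, 1 - 1 / Real.sqrt 3, 1 / Real.sqrt 3, 1 / Real.sqrt 3,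
        1 / Real.sqrt 3, 1 / Real.sqrt 3, 2 - 2 / Real.sqrt 3]
    p ∈ C ∧ IsLocalMaxOn atrial C p ∧ atrial p = 3 * Real.sqrt 3 * N ^ 2 / 8 := by
  intro C atrial p
  have h3 : Real.sqrt 3 = 3 * (1 / Real.sqrt 3) := by
    have h := Real.mul_self_sqrt (show (0:ℝ) ≤ 3 by norm_num)
    have h0 : 0 < Real.sqrt 3 := Real.sqrt_pos.mpr (by norm_num)
    field_simp
    nlinarith
  obtain ⟨s, hs⟩ : ∃ s, s = 1 / Real.sqrt 3 := ⟨_, rfl⟩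
  have hs0 : 0 < s := by rw [hs]; positivity
  have hs2 : s ^ 2 = 1 / 3 := by
    rw [hs, div_pow, Real.sq_sqrt (by norm_num)]; norm_num
  have hs1 : s < 1 := by nlinarith
  have hp : p = ![1 - s, 1 - s, s, s, s, s, 2 - 2 * s] := by
    simp only [p, hs]
    rw [show (2:ℝ) / Real.sqrt 3 = 2 * (1 / Real.sqrt 3) by ring]
  have p0 : p 0 = 1 - s := by rw [hp]; rfl
  have p1 : p 1 = 1 - s := by rw [hp]; rfl
  have p2 : p 2 = s := by rw [hp]; rfl
  have p3 : p 3 = s := by rw [hp]; rfl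
  have p4 : p 4 = s := by rw [hp]; rfl
  have p5 : p 5 = s := by rw [hp]; rfl
  have p6 : p 6 = 2 - 2 * s := by rw [hp]; rfl
  have hval : atrial p = (9 * N ^ 2 / 32) * (4 * s) := by
    simp only [atrial, p0, p1, p2, p3, p4, p5, p6]
    linear_combination (9 * N ^ 2 / 32) * (-6 * s) * hs2
  refine ⟨?_, ?_, ?_⟩
  · show p 0 + p 1 + p 4 + p 5 = 2 ∧ p 4 + p 5 = p 2 + p 3 ∧ p 0 + p 1 = p 6
    rw [p0, p1, p2, p3, p4, p5, p6]
    refine ⟨by ring, by ring, by ring⟩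
  · have e1 : ∀ᶠ R : Fin 7 → ℝ in nhds p, 0 < R 4 + R 5 :=
      (by fun_prop : Continuous fun R : Fin 7 → ℝ => R 4 + R 5).continuousAt.eventually
        (lt_mem_nhds (by beta_reduce; rw [p4, p5]; linarith))
    have e2 : ∀ᶠ R : Fin 7 → ℝ in nhds p, R 4 + R 5 < 2 :=
      (by fun_prop : Continuous fun R : Fin 7 → ℝ => R 4 + R 5).continuousAt.eventually
        (gt_mem_nhds (by beta_reduce; rw [p4, p5]; linarith))
    have key : ∀ᶠ R in nhdsWithin p C, atrial R ≤ atrial p := by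
      filter_upwards [nhdsWithin_le_nhds e1, nhdsWithin_le_nhds e2, self_mem_nhdsWithin]
        with R h1 h2 hC
      obtain ⟨c1, c2, c3⟩ := hC
      rw [hval]
      simp only [atrial]
      apply mul_le_mul_of_nonneg_left _ (by positivity)
      obtain ⟨x, hx⟩ : ∃ x, x = (R 4 + R 5) / 2 := ⟨_, rfl⟩
      obtain ⟨a, ha⟩ : ∃ a, a = (R 0 - R 1) / 2 := ⟨_, rfl⟩
      obtain ⟨b, hb⟩ : ∃ b, b = (R 2 - R 3) / 2 := ⟨_, rfl⟩
      obtain ⟨c, hc⟩ : ∃ c, c = (R 4 - R 5) / 2 := ⟨_, rfl⟩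
      rw [show R 0 = 1 - x + a by linarith, show R 1 = 1 - x - a by linarith,
        show R 2 = x + b by linarith, show R 3 = x - b by linarith,
        show R 4 = x + c by linarith, show R 5 = x - c by linarith,
        show R 6 = 2 - 2 * x by linarith]
      have hx0 : 0 < x := by linarith
      have hx1 : 0 < 1 - x := by linarith
      have t1 : 0 ≤ x * a ^ 2 := by positivity
      have t2 : 0 ≤ (1 - x) * (b ^ 2 + c ^ 2) := by positivity
      have t3 : 0 ≤ (x - s) ^ 2 * (x + 2 * s) := by positivity
      have id : (3 + (1 - x + a - 1) ^ 3 + (1 - x - a - 1) ^ 3 + (x + b - 1) ^ 3 +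
          (x - b - 1) ^ 3 + (x + c - 1) ^ 3 + (x - c - 1) ^ 3 + (2 - 2 * x - 1) ^ 3)
          = 4 * s - 6 * (x * a ^ 2) - 6 * ((1 - x) * (b ^ 2 + c ^ 2))
            - 6 * ((x - s) ^ 2 * (x + 2 * s)) := by
        linear_combination (12 * s - 18 * x) * hs2
      linarith
    exact key
  · rw [hval, h3, ← hs]; ring
end

section
/- Let m and n be positive integers, fix N > 0, and let ξ₂ ∈ (0, 3(m+n)/2). Set S = 3(m+n)/2 − ξ₂, Vol(Σ₁) = Vol(Σ₂) = 4π²/(3S), Vol(Σ₃) = Vol(Σ₄) = 4π²/(3ξ₂), Vol(Y) = (π/6)·(Vol(Σ₁) + Vol(Σ₂) + Vol(Σ₃) + Vol(Σ₄)), Z = Vol(Y)/π³, and R_α = π·Vol(Σ_α)/(3·Vol(Y)) for α = 1,2,3,4. Then (i) R₁ + R₄ = 1 and R₂ + R₃ = 1, and (ii) with a_trial = (27N²/32)·(m·R₂R₃ + n·R₁R₄), one has Z · a_trial = N²/4 identically in ξ₂. -/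
open Real

/-- Equivalence of Z-minimization and a-maximization for the mass-deformed L^{m,n,m}
theories: with trial R-charges R_α = π·Vol(Σ_α)/(3·Vol(Y)) determined by the contact
volumes, (i) R₁ + R₄ = 1 and R₂ + R₃ = 1, and (ii) Z · a_trial = N²/4 identically in ξ₂. -/
theorem Z_times_a_trial_mLmnm (m n : ℕ) (hm : 0 < m) (hn : 0 < n)
    (N : ℝ) (hN : 0 < N)
    (ξ₂ : ℝ) (hξ : ξ₂ ∈ Set.Ioo (0 : ℝ) (3 * ((m : ℝ) + n) / 2))
    (S V₁ V₂ V₃ V₄ VY Z R₁ R₂ R₃ R₄ atrial : ℝ)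
    (hS : S = 3 * ((m : ℝ) + n) / 2 - ξ₂)
    (hV₁ : V₁ = 4 * π ^ 2 / (3 * S))
    (hV₂ : V₂ = 4 * π ^ 2 / (3 * S))
    (hV₃ : V₃ = 4 * π ^ 2 / (3 * ξ₂))
    (hV₄ : V₄ = 4 * π ^ 2 / (3 * ξ₂))
    (hVY : VY = (π / 6) * (V₁ + V₂ + V₃ + V₄))
    (hZ : Z = VY / π ^ 3)
    (hR₁ : R₁ = π * V₁ / (3 * VY))
    (hR₂ : R₂ = π * V₂ / (3 * VY))
    (hR₃ : R₃ = π * V₃ / (3 * VY))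
    (hR₄ : R₄ = π * V₄ / (3 * VY))
    (ha : atrial = (27 * N ^ 2 / 32) * ((m : ℝ) * R₂ * R₃ + (n : ℝ) * R₁ * R₄)) :
    (R₁ + R₄ = 1 ∧ R₂ + R₃ = 1) ∧ Z * atrial = N ^ 2 / 4 := by
  obtain ⟨h0, h1⟩ := hξ
  have hSp : 0 < S := by rw [hS]; linarith
  have hT : 0 < S + ξ₂ := by linarith
  have hmn : (m : ℝ) + n = 2 * (S + ξ₂) / 3 := by rw [hS]; ring
  have hp := Real.pi_pos
  have hp0 := hp.ne'
  have hS0 := hSp.ne'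
  have hx0 := h0.ne'
  have hT0 := hT.ne'
  clear hS
  have hVY' : VY = 4 * π ^ 3 * (S + ξ₂) / (9 * (S * ξ₂)) := by
    rw [hVY, hV₁, hV₂, hV₃, hV₄]; field_simp; ring
  have e1 : R₁ = ξ₂ / (S + ξ₂) := by
    rw [hR₁, hVY', hV₁]; field_simp; try ring
  have e2 : R₂ = ξ₂ / (S + ξ₂) := by
    rw [hR₂, hVY', hV₂]; field_simp; try ring
  have e3 : R₃ = S / (S + ξ₂) := by
    rw [hR₃, hVY', hV₃]; field_simp; try ring
  have e4 : R₄ = S / (S + ξ₂) := by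
    rw [hR₄, hVY', hV₄]; field_simp; try ring
  have ea : atrial = (27 * N ^ 2 / 32) * (((m : ℝ) + n) * (ξ₂ / (S + ξ₂)) * (S / (S + ξ₂))) := by
    rw [ha, e1, e2, e3, e4]; ring
  refine ⟨⟨?_, ?_⟩, ?_⟩
  · rw [e1, e4, ← add_div, add_comm, div_self hT0]
  · rw [e2, e3, ← add_div, add_comm, div_self hT0]
  · rw [hZ, ea, hVY', hmn]; field_simp; norm_num
end

section
/- Let m and n be positive integers with m < n. Then (i) (2m−n)(2n−m)(m+n) + 2(m² − mn + n²)^{3/2} > 0, and (ii) (m+n)·[(2m−n)(2n−m)(m+n) + 2(m² − mn + n²)^{3/2}] < 8m²n². Equivalently, the central charge of the mass-deformed L^{m,n,m} theory, a_{mL} = 27(m+n)N²/128, is strictly smaller than that of the undeformed theory, a_{L^{m,n,m}} = 27N²m²n²/(16[(2m−n)(2n−m)(m+n) + 2(m²−mn+n²)^{3/2}]). -/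
/-- a-theorem check for the mass-deformed generalized conifolds: for 0 < m < n,
(i) the denominator D = (2m−n)(2n−m)(m+n) + 2(m²−mn+n²)^{3/2} is positive, and
(ii) (m+n)·D < 8m²n²; equivalently 27(m+n)N²/128 < 27N²m²n²/(16D) for any N > 0. -/
theorem a_mLmnm_lt_a_Lmnm (m n : ℕ) (hm : 0 < m) (hmn : m < n) :
    (0 < (2 * (m : ℝ) - n) * (2 * (n : ℝ) - m) * ((m : ℝ) + n) +
        2 * ((m : ℝ) ^ 2 - m * n + n ^ 2) ^ ((3 : ℝ) / 2)) ∧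
    (((m : ℝ) + n) * ((2 * (m : ℝ) - n) * (2 * (n : ℝ) - m) * ((m : ℝ) + n) +
        2 * ((m : ℝ) ^ 2 - m * n + n ^ 2) ^ ((3 : ℝ) / 2)) < 8 * (m : ℝ) ^ 2 * n ^ 2) ∧
    (∀ N : ℝ, 0 < N →
      27 * ((m : ℝ) + n) * N ^ 2 / 128 <
        27 * N ^ 2 * (m : ℝ) ^ 2 * n ^ 2 /
          (16 * ((2 * (m : ℝ) - n) * (2 * (n : ℝ) - m) * ((m : ℝ) + n) +
            2 * ((m : ℝ) ^ 2 - m * n + n ^ 2) ^ ((3 : ℝ) / 2)))) := by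
  have ha : (0 : ℝ) < m := by exact_mod_cast hm
  have hab : (m : ℝ) < n := by exact_mod_cast hmn
  generalize (m : ℝ) = a at *
  generalize (n : ℝ) = b at *
  have hb : 0 < b := ha.trans hab
  have hp : 0 < a * b := mul_pos ha hb
  have hQ : 0 < a ^ 2 - a * b + b ^ 2 := by nlinarith [sq_nonneg (a - b)]
  obtain ⟨q, hq, hq2⟩ : ∃ q : ℝ, 0 < q ∧ q ^ 2 = a ^ 2 - a * b + b ^ 2 :=
    ⟨√(a ^ 2 - a * b + b ^ 2), Real.sqrt_pos.2 hQ, Real.sq_sqrt hQ.le⟩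
  have hpow : (a ^ 2 - a * b + b ^ 2) ^ ((3 : ℝ) / 2) = q ^ 3 := by
    rw [← hq2, ← Real.rpow_natCast q 2, ← Real.rpow_mul hq.le, ← Real.rpow_natCast q 3]
    norm_num
  rw [hpow]
  have h1 : q < a + b := by
    apply lt_of_pow_lt_pow_left₀ 2 (by positivity)
    nlinarith
  have h2 : a + b < 2 * q := by
    apply lt_of_pow_lt_pow_left₀ 2 (by positivity)
    nlinarith [pow_pos (sub_pos.2 hab) 2]
  have hpq : a * b = (a + b - q) * (a + b + q) / 3 := by linarith
  have hD : (2 * a - b) * (2 * b - a) * (a + b) + 2 * q ^ 3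
      = (a + b - q) ^ 2 * (a + b + 2 * q) := by
    have : (2 * a - b) * (2 * b - a) = 9 * (a * b) - 2 * (a + b) ^ 2 := by ring
    rw [this, hpq]; ring
  rw [hD]
  have hs : 0 < a + b - q := by linarith
  have hDpos : 0 < (a + b - q) ^ 2 * (a + b + 2 * q) := by positivity
  have key : (a + b) * ((a + b - q) ^ 2 * (a + b + 2 * q)) < 8 * a ^ 2 * b ^ 2 := by
    have e : 8 * a ^ 2 * b ^ 2 = 8 * (a * b) ^ 2 := by ring
    rw [e, hpq]
    have : 0 < (a + b - q) ^ 2 * ((2 * q - (a + b)) * (4 * q + (a + b))) := by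
      have : 0 < 2 * q - (a + b) := by linarith
      positivity
    linarith
  refine ⟨hDpos, key, fun N hN => ?_⟩
  rw [div_lt_div_iff₀ (by norm_num) (by positivity)]
  have := mul_lt_mul_of_pos_left key (show 0 < 432 * N ^ 2 by positivity)
  linarith
end

section
/- Let m and n be coprime positive integers. The set of quadruples (a₁, a₂, a₃, a₄) ∈ ℕ⁴ satisfying m·a₁ + n·a₃ = n·a₂ + m·a₄ is exactly the additive submonoid of ℕ⁴ generated by the four elements (1,0,0,1), (0,1,1,0), (n,m,0,0), (0,0,m,n). -/
/-- U(1)_B-invariant monomials for the generalized conifold: for coprime positive m, n,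
the quadruples (a₁,a₂,a₃,a₄) ∈ ℕ⁴ with m·a₁ + n·a₃ = n·a₂ + m·a₄ form exactly the
additive submonoid generated by (1,0,0,1), (0,1,1,0), (n,m,0,0), (0,0,m,n). -/
theorem invariant_monomials_generalized_conifold (m n : ℕ) (hm : 0 < m) (hn : 0 < n)
    (hcop : Nat.Coprime m n) :
    {a : Fin 4 → ℕ | m * a 0 + n * a 2 = n * a 1 + m * a 3} =
      (AddSubmonoid.closure
        ({![1, 0, 0, 1], ![0, 1, 1, 0], ![n, m, 0, 0], ![0, 0, m, n]} :
          Set (Fin 4 → ℕ)) : AddSubmonoid (Fin 4 → ℕ)) := by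
  have key : ∀ d e : ℕ, m * d = n * e → ∃ k, d = n * k ∧ e = m * k := by
    intro d e h
    obtain ⟨k, rfl⟩ : n ∣ d := hcop.symm.dvd_of_dvd_mul_left ⟨e, h⟩
    refine ⟨k, rfl, ?_⟩
    apply Nat.eq_of_mul_eq_mul_left hn
    rw [← h]; ring
  ext a
  simp only [Set.mem_setOf_eq, SetLike.mem_coe]
  constructor
  · intro h
    have g : ∀ x ∈ ({![1, 0, 0, 1], ![0, 1, 1, 0], ![n, m, 0, 0], ![0, 0, m, n]} :
        Set (Fin 4 → ℕ)), ∀ k : ℕ, k • x ∈ AddSubmonoid.closure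
        ({![1, 0, 0, 1], ![0, 1, 1, 0], ![n, m, 0, 0], ![0, 0, m, n]} : Set (Fin 4 → ℕ)) :=
      fun x hx k => AddSubmonoid.nsmul_mem _ (AddSubmonoid.subset_closure hx) k
    rcases le_total (a 3) (a 0) with h1 | h1
    · obtain ⟨d, hd⟩ := Nat.exists_eq_add_of_le h1
      have h2 : a 2 ≤ a 1 := by
        apply Nat.le_of_mul_le_mul_left _ hn
        rw [hd] at h
        nlinarith [Nat.zero_le (m * d)]
      obtain ⟨e, he⟩ := Nat.exists_eq_add_of_le h2
      obtain ⟨k, rfl, rfl⟩ := key d e (by rw [hd, he] at h; linarith)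
      have : a = a 3 • ![1, 0, 0, 1] + a 2 • ![0, 1, 1, 0] + k • ![n, m, 0, 0] := by
        ext i
        fin_cases i <;> simp [hd, he, mul_comm]
      rw [this]
      exact add_mem (add_mem (g _ (by simp) _) (g _ (by simp) _)) (g _ (by simp) _)
    · obtain ⟨d, hd⟩ := Nat.exists_eq_add_of_le h1
      have h2 : a 1 ≤ a 2 := by
        apply Nat.le_of_mul_le_mul_left _ hn
        rw [hd] at h
        nlinarith [Nat.zero_le (m * d)]
      obtain ⟨e, he⟩ := Nat.exists_eq_add_of_le h2
      obtain ⟨k, rfl, rfl⟩ := key d e (by rw [hd, he] at h; linarith)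
      have : a = a 0 • ![1, 0, 0, 1] + a 1 • ![0, 1, 1, 0] + k • ![0, 0, m, n] := by
        ext i
        fin_cases i <;> simp [hd, he, mul_comm]
      rw [this]
      exact add_mem (add_mem (g _ (by simp) _) (g _ (by simp) _)) (g _ (by simp) _)
  · intro h
    induction h using AddSubmonoid.closure_induction with
    | mem x hx =>
      simp only [Set.mem_insert_iff, Set.mem_singleton_iff] at hx
      rcases hx with rfl | rfl | rfl | rfl <;> simp [mul_comm]
    | zero => simp
    | add x y _ _ hx hy =>
      simp only [Pi.add_apply]
      linarith
end

section
/- Let m and n be integers with 1 ≤ m ≤ n and gcd(m, n) = 1, and let v₁ = (1, n, 0), v₂ = (1, m, 1), v₃ = (1, 0, 1), v₄ = (1, 0, 0) in ℤ³. Then the set of lattice points {y ∈ ℤ³ : ⟨y, v_a⟩ ≥ 0 for a = 1, 2, 3, 4} (inner product the standard one on ℤ³) equals the set of all ℕ-linear combinations of the four vectors u = (1, 0, −1), v = (0, 0, 1), w = (0, 1, 0), z = (n, −1, m − n). -/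
/-- Lattice points of the moment cone of the generalized conifold C(L^{m,n,m}):
for 1 ≤ m ≤ n coprime, the lattice points y ∈ ℤ³ with ⟨y, v_a⟩ ≥ 0 for the normals
v₁ = (1,n,0), v₂ = (1,m,1), v₃ = (1,0,1), v₄ = (1,0,0) are exactly the ℕ-linear
combinations of u = (1,0,−1), v = (0,0,1), w = (0,1,0), z = (n,−1,m−n). -/
theorem lattice_points_generalized_conifold (m n : ℕ) (hm : 1 ≤ m) (hmn : m ≤ n)
    (hcop : Nat.Coprime m n) :
    {y : Fin 3 → ℤ |
        0 ≤ y 0 * 1 + y 1 * (n : ℤ) + y 2 * 0 ∧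
        0 ≤ y 0 * 1 + y 1 * (m : ℤ) + y 2 * 1 ∧
        0 ≤ y 0 * 1 + y 1 * 0 + y 2 * 1 ∧
        0 ≤ y 0 * 1 + y 1 * 0 + y 2 * 0} =
      {y : Fin 3 → ℤ | ∃ a b c d : ℕ,
        y = (a : ℤ) • ![1, 0, -1] + (b : ℤ) • ![0, 0, 1] + (c : ℤ) • ![0, 1, 0] +
          (d : ℤ) • ![(n : ℤ), -1, (m : ℤ) - n]} := by
  ext y
  simp only [Set.mem_setOf_eq]
  constructor
  · rintro ⟨h1, h2, h3, h4⟩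
    rcases le_total 0 (y 1) with h | h
    · obtain ⟨a, ha⟩ := Int.eq_ofNat_of_zero_le h4
      obtain ⟨b, hb⟩ := Int.eq_ofNat_of_zero_le h3
      obtain ⟨c, hc⟩ := Int.eq_ofNat_of_zero_le h
      refine ⟨a, b, c, 0, ?_⟩
      ext i
      fin_cases i <;> simp <;> linarith
    · obtain ⟨a, ha⟩ := Int.eq_ofNat_of_zero_le h1
      obtain ⟨b, hb⟩ := Int.eq_ofNat_of_zero_le h2
      obtain ⟨d, hd⟩ := Int.eq_ofNat_of_zero_le (neg_nonneg.mpr h)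
      have hy : y 1 = -(d : ℤ) := by linarith
      rw [hy] at ha hb
      refine ⟨a, b, 0, d, ?_⟩
      ext i
      fin_cases i <;> simp <;> linarith
  · rintro ⟨a, b, c, d, rfl⟩
    simp
    have e1 : (a : ℤ) + d * n + (c + -d) * n = a + c * n := by ring
    have e2 : (a : ℤ) + d * n + (c + -d) * m + (-a + b + d * (m - n)) = b + c * m := by ring
    have e3 : (a : ℤ) + d * n + (-a + b + d * (m - n)) = b + d * m := by ring
    refine ⟨?_, ?_, ?_, ?_⟩
    · rw [e1]; positivity
    · rw [e2]; positivity
    · rw [e3]; positivity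
    · positivity
end
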